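/- arXiv:2312.02680 — 2 statements merged into one kernel-verified Lean document; each statement's English description precedes it below -/
import Mathlib

section
/- Let G be a finite connected simple graph containing a cycle, with girth g satisfying g ≡ 2 or 3 (mod 4), and suppose G is not a canonical unicyclic graph. If n(G) = ⌈g/2⌉, then g = 3. -/
/-- The real adjacency matrix of a simple graph is Hermitian. -/
lemma SimpleGraph.adjMatrix_isHermitian {V : Type*} [Fintype V] [DecidableEq V]
    (G : SimpleGraph V) [DecidableRel G.Adj] : (G.adjMatrix ℝ).IsHermitian := by
  rw [Matrix.IsHermitian, Matrix.conjTranspose_eq_transpose_of_trivial]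
  exact G.isSymm_adjMatrix

/-- The negative inertia index `n(G)`: the number of negative eigenvalues of the real
adjacency matrix of `G`, counted with multiplicity. -/
noncomputable def SimpleGraph.negInertia {V : Type*} [Fintype V] (G : SimpleGraph V) : ℕ := by
  classical
  exact Fintype.card {i // (G.adjMatrix_isHermitian).eigenvalues i < 0}

/-- The positive inertia index `p(G)`: the number of positive eigenvalues of the real
adjacency matrix of `G`, counted with multiplicity. -/
noncomputable def SimpleGraph.posInertia {V : Type*} [Fintype V] (G : SimpleGraph V) : ℕ := by
  classical
  exact Fintype.card {i // 0 < (G.adjMatrix_isHermitian).eigenvalues i}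

/-- A connected graph is a *canonical unicyclic graph* if it has exactly one cycle `C`
(any two cycles have the same edge set) and the vertices outside `C` form an
independent set. -/
def SimpleGraph.IsCanonicalUnicyclic {V : Type*} (G : SimpleGraph V) : Prop :=
  G.Connected ∧
    ∃ (a : V) (c : G.Walk a a), c.IsCycle ∧
      (∀ (b : V) (d : G.Walk b b), d.IsCycle → ∀ e, e ∈ d.edges ↔ e ∈ c.edges) ∧
      (∀ x y : V, x ∉ c.support → y ∉ c.support → ¬ G.Adj x y)

open Module SimpleGraph
open scoped Matrix

/-- A linear family of vectors on which the quadratic form of a Hermitian real matrix is negative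
definite is no larger than the number of negative eigenvalues. -/
theorem Matrix.IsHermitian.finrank_le_card_neg_eigenvalues {n E : Type*} [Fintype n]
    [DecidableEq n] {M : Matrix n n ℝ} (hM : M.IsHermitian) [AddCommGroup E] [Module ℝ E]
    [FiniteDimensional ℝ E] (L : E →ₗ[ℝ] n → ℝ) (hL : ∀ e ≠ 0, L e ⬝ᵥ M.mulVec (L e) < 0) :
    finrank ℝ E ≤ Fintype.card {i // hM.eigenvalues i < 0} := by
  by_contra! hlt
  let b := hM.eigenvectorBasis
  let T : E →ₗ[ℝ] {i // hM.eigenvalues i < 0} → ℝ :=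
    LinearMap.pi fun i => (dotProductBilin ℝ ℝ (b i.1).ofLp).comp L
  have hT : LinearMap.ker T ≠ ⊥ := LinearMap.ker_ne_bot_of_finrank_lt (by simpa using hlt)
  obtain ⟨e, he, he0⟩ := (Submodule.ne_bot_iff _).mp hT
  refine absurd (hL e he0) (not_lt.mpr ?_)
  have hTe : ∀ i, hM.eigenvalues i < 0 → (b i).ofLp ⬝ᵥ L e = 0 := fun i hi => by
    have := congrFun (LinearMap.mem_ker.mp he) ⟨i, hi⟩
    simpa [T] using this
  have hexp : L e ⬝ᵥ M.mulVec (L e) = ∑ i, hM.eigenvalues i * ((b i).ofLp ⬝ᵥ L e) ^ 2 := by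
    have h := b.sum_inner_mul_inner (WithLp.toLp 2 (L e)) (WithLp.toLp 2 (M.mulVec (L e)))
    have h1 : inner ℝ (WithLp.toLp 2 (L e)) (WithLp.toLp 2 (M.mulVec (L e)))
        = L e ⬝ᵥ M.mulVec (L e) := by
      simp [EuclideanSpace.inner_eq_star_dotProduct, dotProduct_comm]
    rw [← h1, ← h]
    refine Finset.sum_congr rfl fun i _ => ?_
    have h2 : (b i).ofLp ⬝ᵥ M.mulVec (L e) = hM.eigenvalues i * ((b i).ofLp ⬝ᵥ L e) := by
      have hMt : M.transpose = M := by
        rw [← Matrix.conjTranspose_eq_transpose_of_trivial]; exact hM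
      rw [dotProduct_mulVec, ← mulVec_transpose, hMt, hM.mulVec_eigenvectorBasis, smul_dotProduct]
      rfl
    simp only [EuclideanSpace.inner_eq_star_dotProduct, star_trivial]
    rw [dotProduct_comm (M.mulVec _), h2]
    ring
  rw [hexp]
  refine Finset.sum_nonneg fun i _ => ?_
  rcases lt_or_ge (hM.eigenvalues i) 0 with hi | hi
  · simp [hTe i hi]
  · positivity


theorem Matrix.IsSymm.exists_linearMap_neg_of_submatrix {n I J : Type*} [Fintype n] [Fintype I]
    [Fintype J] {M : Matrix n n ℝ} (hM : M.IsSymm) (ι : I → n) (κ : J → n)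
    (hκ : M.submatrix κ κ = 0) (r : ℝ)
    (h : ∀ x ≠ 0, x ⬝ᵥ M.submatrix ι ι *ᵥ x <
      2 * r * (M.submatrix κ ι *ᵥ x ⬝ᵥ M.submatrix κ ι *ᵥ x)) :
    ∃ L : (I → ℝ) →ₗ[ℝ] n → ℝ, (∀ x ≠ 0, L x ⬝ᵥ M *ᵥ L x < 0) ∧
      ∀ x v, v ∉ Set.range ι → v ∉ Set.range κ → L x v = 0 := by
  classical
  let X : Matrix n I ℝ := (1 : Matrix n n ℝ).submatrix id ι
  let Y : Matrix n J ℝ := (1 : Matrix n n ℝ).submatrix id κ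
  let S : Matrix J I ℝ := M.submatrix κ ι
  have hXX : Xᵀ * M * X = M.submatrix ι ι := by ext; simp [X, Matrix.mul_apply, Matrix.one_apply]
  have hYX : Yᵀ * M * X = S := by ext; simp [X, Y, S, Matrix.mul_apply, Matrix.one_apply]
  have hYY : Yᵀ * M * Y = 0 := by
    rw [← hκ]; ext; simp [Y, Matrix.mul_apply, Matrix.one_apply]
  have hXY : Xᵀ * M * Y = Sᵀ := by
    rw [← hYX]; simp [Matrix.transpose_mul, hM.eq, Matrix.mul_assoc]
  refine ⟨(X - r • (Y * S)).mulVecLin, fun x hx => ?_, fun x v hι hκ => ?_⟩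
  · have hP : (X - r • (Y * S))ᵀ * M * (X - r • (Y * S)) = M.submatrix ι ι - (2 * r) • (Sᵀ * S) := by
      have : (X - r • (Y * S))ᵀ * M * (X - r • (Y * S)) = Xᵀ * M * X - r • ((Xᵀ * M * Y) * S)
          - r • (Sᵀ * (Yᵀ * M * X)) + (r * r) • (Sᵀ * (Yᵀ * M * Y) * S) := by
        simp only [Matrix.transpose_sub, Matrix.transpose_smul, Matrix.transpose_mul,
          Matrix.sub_mul, Matrix.mul_sub, Matrix.smul_mul, Matrix.mul_smul, Matrix.mul_assoc,
          smul_sub, smul_smul]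
        abel
      rw [this, hXX, hXY, hYX, hYY]
      simp only [Matrix.mul_zero, Matrix.zero_mul, smul_zero, two_mul, add_smul]
      abel
    have hq : (X - r • (Y * S)).mulVecLin x ⬝ᵥ M *ᵥ (X - r • (Y * S)).mulVecLin x =
        x ⬝ᵥ M.submatrix ι ι *ᵥ x - 2 * r * (S *ᵥ x ⬝ᵥ S *ᵥ x) := by
      have h1 : ∀ (P : Matrix n I ℝ), P *ᵥ x ⬝ᵥ M *ᵥ P *ᵥ x = x ⬝ᵥ (Pᵀ * M * P) *ᵥ x := by
        intro P
        rw [← Matrix.mulVec_mulVec, ← Matrix.mulVec_mulVec, Matrix.dotProduct_mulVec x Pᵀ,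
          Matrix.vecMul_transpose]
      rw [Matrix.mulVecLin_apply, h1, hP, Matrix.sub_mulVec, dotProduct_sub, Matrix.smul_mulVec,
        dotProduct_smul, ← Matrix.mulVec_mulVec, Matrix.dotProduct_mulVec x Sᵀ,
        Matrix.vecMul_transpose, smul_eq_mul]
    rw [hq]
    linarith [h x hx]
  · have hX : ∀ i, X v i = 0 := fun i => by
      simp only [X, Matrix.submatrix_apply]
      exact Matrix.one_apply_ne fun h => hι ⟨i, h.symm⟩
    have hY : ∀ i, Y v i = 0 := fun i => by
      simp only [Y, Matrix.submatrix_apply]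
      exact Matrix.one_apply_ne fun h => hκ ⟨i, h.symm⟩
    simp [Matrix.mulVec, dotProduct, Matrix.mul_apply, hX, hY]

theorem Matrix.IsSymm.exists_linearMap_neg_prod {n E : Type*} [Fintype n]
    {M : Matrix n n ℝ} (hM : M.IsSymm) [AddCommGroup E] [Module ℝ E] (L : E →ₗ[ℝ] n → ℝ)
    (hL : ∀ e ≠ 0, L e ⬝ᵥ M *ᵥ L e < 0) {x y : n} (hxx : M x x = 0) (hyy : M y y = 0)
    (hxy : M x y = 1) (hy : ∀ e, (M *ᵥ L e) y = 0) :
    ∃ L' : E × ℝ →ₗ[ℝ] n → ℝ, ∀ e ≠ 0, L' e ⬝ᵥ M *ᵥ L' e < 0 := by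
  classical
  let T : E × ℝ →ₗ[ℝ] n → ℝ := L.comp (LinearMap.fst ℝ E ℝ)
  let φ : E × ℝ →ₗ[ℝ] ℝ := (LinearMap.proj x).comp (M.mulVecLin.comp T)
  let ψ : E × ℝ →ₗ[ℝ] ℝ := LinearMap.snd ℝ E ℝ
  let L' : E × ℝ →ₗ[ℝ] n → ℝ :=
    T - ψ.smulRight (Pi.single x 1) + (ψ - φ).smulRight (Pi.single y 1)
  refine ⟨L', ?_⟩
  rintro ⟨e, t⟩ het
  have hyx : M y x = 1 := by rw [← hxy, hM.apply]
  have key : ∀ z : n → ℝ, ∀ a b : ℝ, (M *ᵥ z) y = 0 →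
      (z - a • Pi.single x 1 + b • Pi.single y 1) ⬝ᵥ
        M *ᵥ (z - a • Pi.single x 1 + b • Pi.single y 1) =
      z ⬝ᵥ M *ᵥ z - 2 * a * (M *ᵥ z) x - 2 * a * b := by
    intro z a b hz
    have hs : ∀ i, z ⬝ᵥ M.col i = (M *ᵥ z) i := by
      intro i
      rw [← Matrix.mulVec_single_one, Matrix.dotProduct_mulVec, ← Matrix.mulVec_transpose,
        hM.eq, dotProduct_single_one]
    simp only [Matrix.mulVec_add, Matrix.mulVec_sub, Matrix.mulVec_smul, add_dotProduct,
      sub_dotProduct, dotProduct_add, dotProduct_sub, smul_dotProduct, dotProduct_smul, hs,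
      single_one_dotProduct, smul_eq_mul, hz, Matrix.mulVec_single_one, Matrix.col_apply, hxx,
      hyy, hxy, hyx]
    ring
  have h1 : L' (e, t) =
      L e - t • Pi.single x 1 + (t - (M *ᵥ L e) x) • Pi.single y 1 := rfl
  rw [h1, key _ _ _ (hy e)]
  by_cases he : e = 0
  · have ht : t ≠ 0 := by rintro rfl; exact het (by simp [he])
    have := mul_self_pos.mpr ht
    simp [he]
    nlinarith
  · have := hL e he
    nlinarith [mul_self_nonneg t]

theorem abs_last_sub_le_sum_abs {N : ℕ} (x : Fin (N + 1) → ℝ) :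
    |x (Fin.last N) - (-1) ^ N * x 0| ≤ ∑ j : Fin N, |x j.castSucc + x j.succ| := by
  induction N with
  | zero => simp
  | succ N ih =>
    have h := ih fun i => x i.castSucc
    rw [Fin.sum_univ_castSucc]
    simp only [Fin.castSucc_zero] at h
    have h2 : x (Fin.last (N + 1)) - (-1) ^ (N + 1) * x 0 =
      (x (Fin.last N).castSucc + x (Fin.last N).succ) -
        (x (Fin.last N).castSucc - (-1) ^ N * x 0) := by
      rw [Fin.succ_last]; ring
    rw [h2]
    refine (abs_sub _ _).trans ?_
    simp only [Fin.succ_castSucc]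
    linarith

theorem eq_zero_of_forall_castSucc_add_succ {N : ℕ} {x : Fin (N + 1) → ℝ} (h0 : x 0 = 0)
    (h : ∀ j : Fin N, x j.castSucc + x j.succ = 0) : x = 0 := by
  funext i
  induction i using Fin.induction with
  | zero => exact h0
  | succ j ih => simpa [ih] using h j

theorem mul_last_lt_of_odd {N : ℕ} (hN : Odd N) {x : Fin (N + 1) → ℝ} (hx : x ≠ 0) :
    x 0 * x (Fin.last N) < (N + 1) * ∑ j : Fin N, (x j.castSucc + x j.succ) ^ 2 := by
  have h := abs_last_sub_le_sum_abs x
  rw [hN.neg_one_pow] at h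
  have h2 : (x (Fin.last N) - -1 * x 0) ^ 2 ≤ N * ∑ j : Fin N, (x j.castSucc + x j.succ) ^ 2 := by
    rw [← sq_abs]
    refine (pow_le_pow_left₀ (abs_nonneg _) h 2).trans ?_
    simpa using sq_sum_le_card_mul_sum_sq (s := Finset.univ)
      (f := fun j : Fin N => |x j.castSucc + x j.succ|)
  have h3 : 0 ≤ ∑ j : Fin N, (x j.castSucc + x j.succ) ^ 2 :=
    Finset.sum_nonneg fun j _ => sq_nonneg _
  by_contra! hle
  have h5 : ∑ j : Fin N, (x j.castSucc + x j.succ) ^ 2 = 0 := by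
    nlinarith [sq_nonneg (x 0 ), sq_nonneg (x (Fin.last N)), sq_nonneg (x 0 + x (Fin.last N))]
  have h4 : x 0 = 0 := by
    rw [h5] at h2 hle
    nlinarith [sq_nonneg (x 0 ), sq_nonneg (x (Fin.last N)), sq_nonneg (x 0 + x (Fin.last N))]
  refine hx (eq_zero_of_forall_castSucc_add_succ h4 fun j => ?_)
  exact pow_eq_zero_iff two_ne_zero |>.mp
    ((Finset.sum_eq_zero_iff_of_nonneg fun j _ => sq_nonneg _).mp h5 j (Finset.mem_univ j))

theorem sum_sq_pos_of_even {N : ℕ} (hN : Even N) {x : Fin (N + 1) → ℝ} (hx : x ≠ 0) :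
    0 < ∑ j : Fin N, (x j.castSucc + x j.succ) ^ 2 + (x (Fin.last N) + x 0) ^ 2 := by
  have h3 : 0 ≤ ∑ j : Fin N, (x j.castSucc + x j.succ) ^ 2 :=
    Finset.sum_nonneg fun j _ => sq_nonneg _
  by_contra! hle
  have h1 : x (Fin.last N) + x 0 = 0 := by nlinarith [sq_nonneg (x (Fin.last N) + x 0)]
  have h5 : ∑ j : Fin N, (x j.castSucc + x j.succ) ^ 2 = 0 := by
    nlinarith [sq_nonneg (x (Fin.last N) + x 0)]
  have h6 : ∀ j : Fin N, x j.castSucc + x j.succ = 0 := fun j =>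
    pow_eq_zero_iff two_ne_zero |>.mp
      ((Finset.sum_eq_zero_iff_of_nonneg fun j _ => sq_nonneg _).mp h5 j (Finset.mem_univ j))
  refine hx (eq_zero_of_forall_castSucc_add_succ ?_ h6)
  have h := abs_last_sub_le_sum_abs x
  simp only [h6, abs_zero, Finset.sum_const_zero, hN.neg_one_pow] at h
  have := abs_nonpos_iff.mp h
  linarith

theorem SimpleGraph.girth_le_length_add_length_of_isPath {V : Type*} {G : SimpleGraph V} {u v : V}
    {p q : G.Walk u v} (hp : p.IsPath) (hq : q.IsPath) (hpq : p ≠ q) :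
    G.girth ≤ p.length + q.length := by
  classical
  let H : SimpleGraph V := fromEdgeSet {e | e ∈ p.edges ∨ e ∈ q.edges}
  have hmem : ∀ e, (e ∈ p.edges ∨ e ∈ q.edges) → e ∈ H.edgeSet := by
    intro e he
    have : e ∈ G.edgeSet := he.elim (fun h => p.edges_subset_edgeSet h)
      (fun h => q.edges_subset_edgeSet h)
    rw [edgeSet_fromEdgeSet]
    exact ⟨he, G.not_isDiag_of_mem_edgeSet this⟩
  have hHG : ∀ e ∈ H.edgeSet, e ∈ p.edges ∨ e ∈ q.edges := by
    intro e he
    rw [edgeSet_fromEdgeSet] at he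
    exact he.1
  have hle : H ≤ G := by
    rw [← edgeSet_subset_edgeSet]
    intro e he
    exact (hHG e he).elim (fun h => p.edges_subset_edgeSet h)
      (fun h => q.edges_subset_edgeSet h)
  have hcyc : ¬ H.IsAcyclic := by
    intro h
    have := (isAcyclic_iff_subsingleton_path.mp h u v).elim
      ⟨p.transfer H fun e he => hmem e (.inl he), hp.transfer _⟩
      ⟨q.transfer H fun e he => hmem e (.inr he), hq.transfer _⟩
    apply hpq
    have h2 := congrArg (fun w => (Subtype.val w).support) this
    simp only [Walk.support_transfer] at h2
    exact Walk.ext_support h2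
  unfold IsAcyclic at hcyc
  push Not at hcyc
  obtain ⟨a, c, hc⟩ := hcyc
  refine (girth_le_length (hc.mapLe hle)).trans ?_
  rw [Walk.length_mapLe, ← Walk.length_edges c, ← p.length_edges, ← q.length_edges,
    ← List.length_append]
  rw [← List.toFinset_card_of_nodup hc.edges_nodup]
  refine (Finset.card_le_card fun e he => ?_).trans (List.toFinset_card_le _)
  rw [List.mem_toFinset] at he ⊢
  exact List.mem_append.mpr (hHG e (c.edges_subset_edgeSet he))

theorem SimpleGraph.Walk.IsCycle.exists_rotate_girth_le {V : Type*} {G : SimpleGraph V} {a u v : V}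
    {c : G.Walk a a} (hc : c.IsCycle) (hu : u ∈ c.support) (hv : v ∈ c.support) (huv : u ≠ v)
    {q : G.Walk u v} (hq : q.IsPath) {e : Sym2 V} (heq : e ∈ q.edges) (hec : e ∉ c.edges) :
    ∃ (d : G.Walk u u) (j : ℕ), d.IsCycle ∧ d.length = c.length ∧ (∀ e, e ∈ d.edges ↔ e ∈ c.edges) ∧
      0 < j ∧ j < c.length ∧ d.getVert j = v ∧ G.girth ≤ j + q.length ∧
      G.girth ≤ c.length - j + q.length := by
  classical
  have hed : ∀ e, e ∈ (c.rotate u hu).edges ↔ e ∈ c.edges := fun e =>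
    (c.rotate_edges u hu).mem_iff
  have hlen : (c.rotate u hu).length = c.length := by simp
  have hdc := hc.rotate hu
  have hvd : v ∈ (c.rotate u hu).support := by
    rw [Walk.mem_support_rotate_iff]; exact hv
  generalize c.rotate u hu = d at *
  obtain ⟨j, rfl, hj⟩ := Walk.mem_support_iff_exists_getVert.mp hvd
  have hj0 : 0 < j := by
    rcases Nat.eq_zero_or_pos j with rfl | h
    · simp at huv
    · exact h
  have hjl : j < c.length := by
    rcases (hlen ▸ hj).lt_or_eq with h | h
    · exact h
    · rw [h, ← hlen] at huv; simp at huv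
  refine ⟨d, j, hdc, hlen, hed, hj0, hjl, rfl, ?_, ?_⟩
  · have h := girth_le_length_add_length_of_isPath (hdc.isPath_take (hlen ▸ hjl)) hq (by
      rintro h
      rw [← h] at heq
      exact hec ((hed e).1 ((d.isSubwalk_take j).edges_subset heq)))
    simpa [Walk.take_length, hj] using h
  · have h := girth_le_length_add_length_of_isPath (hdc.isPath_drop hj0).reverse hq (by
      rintro h
      rw [← h, Walk.edges_reverse, List.mem_reverse] at heq
      exact hec ((hed e).1 ((d.isSubwalk_drop j).edges_subset heq)))
    simpa [hlen] using h

theorem SimpleGraph.Walk.IsCycle.mem_edges_of_adj {V : Type*} {G : SimpleGraph V} {a u v : V}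
    {c : G.Walk a a} (hc : c.IsCycle) (hlen : c.length = G.girth) (hu : u ∈ c.support)
    (hv : v ∈ c.support) (huv : G.Adj u v) : s(u, v) ∈ c.edges := by
  by_contra hec
  obtain ⟨d, j, -, -, -, hj0, hjl, -, h1, h2⟩ := hc.exists_rotate_girth_le hu hv huv.ne
    (q := huv.toWalk) (by simpa using huv.ne) (e := s(u, v)) (by simp) hec
  have := hc.three_le_length
  simp at h1 h2
  omega

theorem SimpleGraph.Walk.IsCycle.getVert_inj {V : Type*} {G : SimpleGraph V} {a : V}
    {c : G.Walk a a} (hc : c.IsCycle) {i j : ℕ} (hi : i < c.length) (hj : j < c.length) :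
    c.getVert i = c.getVert j ↔ i = j :=
  ⟨fun h => hc.getVert_injOn' (by simp only [Set.mem_ofPred_eq]; omega)
    (by simp only [Set.mem_ofPred_eq]; omega) h, fun h => h ▸ rfl⟩

theorem SimpleGraph.Walk.IsCycle.adj_getVert_iff {V : Type*} {G : SimpleGraph V} {a : V}
    {c : G.Walk a a} (hc : c.IsCycle) (hlen : c.length = G.girth) {i j : ℕ} (hi : i < c.length)
    (hj : j < c.length) : G.Adj (c.getVert i) (c.getVert j) ↔
      j = i + 1 ∨ i = j + 1 ∨ (i = 0 ∧ j + 1 = c.length) ∨ (j = 0 ∧ i + 1 = c.length) := by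
  have hsucc : ∀ {i j : ℕ}, i < c.length → j < c.length → c.getVert (i + 1) = c.getVert j →
      j = i + 1 ∨ (j = 0 ∧ i + 1 = c.length) := by
    intro i j hi hj h
    rcases (Nat.succ_le_of_lt hi).lt_or_eq with h' | h'
    · exact .inl ((hc.getVert_inj h' hj).mp h).symm
    · rw [show i + 1 = c.length from h', c.getVert_length] at h
      exact .inr ⟨((hc.getVert_inj (by omega) hj).mp (c.getVert_zero.trans h)).symm, h'⟩
  constructor
  · intro h
    have := hc.mem_edges_of_adj hlen (c.getVert_mem_support i) (c.getVert_mem_support j) h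
    obtain ⟨k, hk, hkk⟩ := c.mk_mem_edges_iff_exists.mp this
    rw [Sym2.eq_iff] at hkk
    rcases hkk with ⟨h1, h2⟩ | ⟨h1, h2⟩
    · obtain rfl := (hc.getVert_inj hk hi).mp h1
      have := hsucc hk hj h2
      tauto
    · obtain rfl := (hc.getVert_inj hk hj).mp h1
      have := hsucc hk hi h2
      tauto
  · rintro (rfl | rfl | ⟨rfl, h⟩ | ⟨rfl, h⟩)
    · exact c.adj_getVert_succ hi
    · exact (c.adj_getVert_succ hj).symm
    · have := c.adj_getVert_succ hj
      rw [h, c.getVert_length] at this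
      simpa using this.symm
    · have := c.adj_getVert_succ hi
      rw [h, c.getVert_length] at this
      simpa using this

theorem SimpleGraph.Walk.IsCycle.eq_of_adj_of_adj {V : Type*} {G : SimpleGraph V} {a u v x : V}
    {c : G.Walk a a} (hc : c.IsCycle) (hlen : c.length = G.girth) (hg : 4 < G.girth)
    (hu : u ∈ c.support) (hv : v ∈ c.support) (hx : x ∉ c.support) (hxu : G.Adj x u)
    (hxv : G.Adj x v) : u = v := by
  by_contra huv
  obtain ⟨d, j, -, -, -, hj0, hjl, -, h1, h2⟩ := hc.exists_rotate_girth_le hu hv huv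
    (q := .cons hxu.symm hxv.toWalk) (by simp [huv, hxu.ne', hxv.ne]) (e := s(x, v)) (by simp)
    (fun h => hx (c.fst_mem_support_of_mem_edges h))
  simp at h1 h2
  omega

theorem SimpleGraph.Walk.IsCycle.girth_le_six {V : Type*} {G : SimpleGraph V} {a u v x y : V}
    {c : G.Walk a a} (hc : c.IsCycle) (hlen : c.length = G.girth) (hg : 6 ≤ G.girth)
    (hu : u ∈ c.support) (hv : v ∈ c.support) (hx : x ∉ c.support) (hy : y ∉ c.support)
    (hux : G.Adj u x) (hxy : G.Adj x y) (hyv : G.Adj y v) :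
    G.girth = 6 ∧ ∃ d : G.Walk u u, d.IsCycle ∧ d.length = 6 ∧ d.getVert 3 = v ∧
      x ∉ d.support ∧ y ∉ d.support := by
  have huv : u ≠ v := by
    rintro rfl
    have := girth_le_length_add_length_of_isPath (p := hxy.toWalk)
      (q := .cons hux.symm hyv.symm.toWalk) (by simp [hxy.ne])
      (by simp [hux.ne', hyv.ne', hxy.ne]) (by
        intro h
        have := congrArg Walk.length h
        simp at this)
    simp at this
    omega
  have hxv : x ≠ v := by rintro rfl; exact hx hv
  have huy : u ≠ y := by rintro rfl; exact hy hu
  obtain ⟨d, j, hd, hdl, hde, hj0, hjl, hdj, h1, h2⟩ := hc.exists_rotate_girth_le hu hv huv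
    (q := .cons hux (.cons hxy hyv.toWalk))
    (by simp [huv, hux.ne, hxy.ne, hyv.ne, hxv, huy]) (e := s(x, y)) (by simp)
    (fun h => hx (c.fst_mem_support_of_mem_edges h))
  simp at h1 h2
  have hds : ∀ w, w ∈ d.support → w ∈ c.support := by
    intro w hw
    obtain ⟨e, he, hwe⟩ := (Walk.mem_support_iff_exists_mem_edges_of_not_nil hd.not_nil).mp hw
    exact c.mem_support_of_mem_edges ((hde e).mp he) hwe
  obtain rfl : j = 3 := by omega
  exact ⟨by omega, d, hd, by omega, hdj, fun h => hx (hds _ h), fun h => hy (hds _ h)⟩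

theorem SimpleGraph.Walk.IsCycle.mem_edges_iff_of_isIndepSet {V : Type*} {G : SimpleGraph V}
    {a b : V} {c : G.Walk a a} (hc : c.IsCycle) (hlen : c.length = G.girth) (hg : 4 < G.girth)
    (hind : ∀ x y, x ∉ c.support → y ∉ c.support → ¬ G.Adj x y) {d : G.Walk b b} (hd : d.IsCycle)
    (e : Sym2 V) : e ∈ d.edges ↔ e ∈ c.edges := by
  classical
  have hsupp : ∀ x ∈ d.support, x ∈ c.support := by
    intro x hx
    by_contra hxc
    have h2 := hd.ncard_neighborSet_toSubgraph_eq_two hx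
    obtain ⟨u, v, huv, h⟩ := Set.ncard_eq_two.mp h2
    have hu : G.Adj x u := d.toSubgraph.adj_sub (show u ∈ d.toSubgraph.neighborSet x by simp [h])
    have hv : G.Adj x v := d.toSubgraph.adj_sub (show v ∈ d.toSubgraph.neighborSet x by simp [h])
    exact huv (hc.eq_of_adj_of_adj hlen hg (by_contra fun h => hind _ _ hxc h hu)
      (by_contra fun h => hind _ _ hxc h hv) hxc hu hv)
  have hsub : d.edges.toFinset ⊆ c.edges.toFinset := by
    intro e he
    rw [List.mem_toFinset] at he ⊢
    induction e with | _ u v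
    exact hc.mem_edges_of_adj hlen (hsupp _ (d.fst_mem_support_of_mem_edges he))
      (hsupp _ (d.snd_mem_support_of_mem_edges he)) (d.adj_of_mem_edges he)
  have heq := Finset.eq_of_subset_of_card_le hsub (by
    rw [List.toFinset_card_of_nodup hc.edges_nodup, List.toFinset_card_of_nodup hd.edges_nodup,
      c.length_edges, d.length_edges, hlen]
    exact girth_le_length hd)
  rw [← List.mem_toFinset, heq, List.mem_toFinset]

theorem SimpleGraph.Walk.IsCycle.exists_linearMap_neg {V : Type*} [Fintype V] {G : SimpleGraph V}
    [DecidableRel G.Adj] {a : V} {c : G.Walk a a} (hc : c.IsCycle) (hlen : c.length = G.girth)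
    (hmod : c.length % 4 = 2 ∨ c.length % 4 = 3) :
    ∃ N, (c.length + 1) / 2 = N + 1 ∧ ∃ L : (Fin (N + 1) → ℝ) →ₗ[ℝ] V → ℝ,
      (∀ x ≠ 0, L x ⬝ᵥ G.adjMatrix ℝ *ᵥ L x < 0) ∧ ∀ x v, v ∉ c.support → L x v = 0 := by
  have h3 := hc.three_le_length
  have hentry : ∀ {i j : ℕ}, i < c.length → j < c.length →
      G.adjMatrix ℝ (c.getVert i) (c.getVert j) =
      if j = i + 1 ∨ i = j + 1 ∨ (i = 0 ∧ j + 1 = c.length) ∨ (j = 0 ∧ i + 1 = c.length)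
        then 1 else 0 := fun hi hj => by
    simp only [adjMatrix_apply, hc.adj_getVert_iff hlen hi hj]
  rcases hmod with hmod | hmod
  · obtain ⟨m, hm⟩ : ∃ m, c.length = 4 * m + 2 := ⟨c.length / 4, by omega⟩
    let ι : Fin (2 * m + 1) → V := fun i => c.getVert (2 * i)
    let κ : Fin (2 * m + 1) → V := fun i => c.getVert (2 * i + 1)
    obtain ⟨L, hL, hs⟩ := G.isSymm_adjMatrix.exists_linearMap_neg_of_submatrix (M := G.adjMatrix ℝ)
      ι κ (by
        ext i j
        simp only [Matrix.submatrix_apply, κ, Matrix.zero_apply]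
        rw [hentry (by omega) (by omega), if_neg (by omega)]) 1 (by
        intro x hx
        have h0 : (G.adjMatrix ℝ).submatrix ι ι = 0 := by
          ext i j
          simp only [Matrix.submatrix_apply, ι, Matrix.zero_apply]
          rw [hentry (by omega) (by omega), if_neg (by omega)]
        have h1 : ∀ j : Fin (2 * m), ((G.adjMatrix ℝ).submatrix κ ι *ᵥ x) j.castSucc =
            x j.castSucc + x j.succ := by
          intro j
          have : ∀ i, (G.adjMatrix ℝ).submatrix κ ι j.castSucc i * x i =
              (if i = j.castSucc then x i else 0) + (if i = j.succ then x i else 0) := by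
            intro i
            simp only [Matrix.submatrix_apply, ι, κ]
            rw [hentry (by simp; omega) (by omega)]
            simp only [Fin.ext_iff, Fin.val_castSucc, Fin.val_succ]
            split_ifs <;> first | omega | grind
          simp only [Matrix.mulVec, dotProduct, this, Finset.sum_add_distrib]
          simp
        have h2 : ((G.adjMatrix ℝ).submatrix κ ι *ᵥ x) (Fin.last (2 * m)) =
            x (Fin.last (2 * m)) + x 0 := by
          have : ∀ i, (G.adjMatrix ℝ).submatrix κ ι (Fin.last (2 * m)) i * x i =
              (if i = Fin.last (2 * m) then x i else 0) + (if i = 0 then x i else 0) := by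
            intro i
            simp only [Matrix.submatrix_apply, ι, κ]
            rw [hentry (by simp; omega) (by omega)]
            simp only [Fin.ext_iff, Fin.val_last, Fin.val_zero]
            split_ifs <;> first | omega | grind
          simp only [Matrix.mulVec, dotProduct, this, Finset.sum_add_distrib]
          simp
        have := sum_sq_pos_of_even (even_two_mul m) hx
        have hS : (G.adjMatrix ℝ).submatrix κ ι *ᵥ x ⬝ᵥ (G.adjMatrix ℝ).submatrix κ ι *ᵥ x =
            ∑ j : Fin (2 * m), (x j.castSucc + x j.succ) ^ 2 +
              (x (Fin.last (2 * m)) + x 0) ^ 2 := by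
          rw [dotProduct, Fin.sum_univ_castSucc]
          simp only [h1, h2, ← sq]
        rw [h0, hS]
        simpa using this)
    refine ⟨2 * m, by omega, L, hL, fun x v hv => hs x v ?_ ?_⟩ <;>
    · rintro ⟨i, rfl⟩
      exact hv (c.getVert_mem_support _)
  · obtain ⟨m, hm⟩ : ∃ m, c.length = 4 * m + 3 := ⟨c.length / 4, by omega⟩
    let ι : Fin (2 * m + 1 + 1) → V := fun i => c.getVert (2 * i)
    let κ : Fin (2 * m + 1) → V := fun i => c.getVert (2 * i + 1)
    obtain ⟨L, hL, hs⟩ := G.isSymm_adjMatrix.exists_linearMap_neg_of_submatrix (M := G.adjMatrix ℝ)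
      ι κ (by
        ext i j
        simp only [Matrix.submatrix_apply, κ, Matrix.zero_apply]
        rw [hentry (by omega) (by omega), if_neg (by omega)])
      (2 * m + 1 + 1) (by
        intro x hx
        have h0 : x ⬝ᵥ (G.adjMatrix ℝ).submatrix ι ι *ᵥ x = 2 * (x 0 * x (Fin.last _)) := by
          have : ∀ i j, x i * ((G.adjMatrix ℝ).submatrix ι ι i j * x j) =
              (if i = 0 then if j = Fin.last _ then x i * x j else 0 else 0) +
              (if i = Fin.last _ then if j = 0 then x i * x j else 0 else 0) := by
            intro i j
            simp only [Matrix.submatrix_apply, ι]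
            rw [hentry (by omega) (by omega)]
            simp only [Fin.ext_iff, Fin.val_last, Fin.val_zero]
            split_ifs <;> first | omega | grind
          simp only [dotProduct, Matrix.mulVec, Finset.mul_sum, this, Finset.sum_add_distrib]
          simp
          ring
        have h1 : ∀ j : Fin (2 * m + 1), ((G.adjMatrix ℝ).submatrix κ ι *ᵥ x) j =
            x j.castSucc + x j.succ := by
          intro j
          have : ∀ i, (G.adjMatrix ℝ).submatrix κ ι j i * x i =
              (if i = j.castSucc then x i else 0) + (if i = j.succ then x i else 0) := by
            intro i
            simp only [Matrix.submatrix_apply, ι, κ]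
            rw [hentry (by omega) (by omega)]
            simp only [Fin.ext_iff, Fin.val_castSucc, Fin.val_succ]
            split_ifs <;> first | omega | grind
          simp only [Matrix.mulVec, dotProduct, this, Finset.sum_add_distrib]
          simp
        have := mul_last_lt_of_odd (odd_two_mul_add_one m) hx
        rw [h0, dotProduct]
        simp only [h1, ← sq]
        push_cast at this
        linarith)
    refine ⟨2 * m + 1, by omega, L, hL, fun x v hv => hs x v ?_ ?_⟩ <;>
    · rintro ⟨i, rfl⟩
      exact hv (c.getVert_mem_support _)

theorem SimpleGraph.Walk.IsCycle.exists_linearMap_neg_of_length_eq_six {V : Type*} [Fintype V]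
    {G : SimpleGraph V} [DecidableRel G.Adj] {a x y : V} {c : G.Walk a a} (hc : c.IsCycle)
    (hlen : c.length = G.girth) (hlen6 : c.length = 6) (hx : x ∉ c.support) (hy : y ∉ c.support)
    (hax : G.Adj a x) (hxy : G.Adj x y) (hy3 : G.Adj y (c.getVert 3)) :
    ∃ L : (Fin 4 → ℝ) →ₗ[ℝ] V → ℝ, ∀ z ≠ 0, L z ⬝ᵥ G.adjMatrix ℝ *ᵥ L z < 0 := by
  have hxi : ∀ i < 6, (G.Adj x (c.getVert i) ↔ i = 0) := fun i hi => by
    refine ⟨fun h => (hc.getVert_inj (by omega) (by omega)).mp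
      (hc.eq_of_adj_of_adj hlen (by omega) (c.getVert_mem_support _)
        (c.getVert_mem_support _) hx h (by simpa using hax.symm)), ?_⟩
    rintro rfl
    simpa using hax.symm
  have hyi : ∀ i < 6, (G.Adj y (c.getVert i) ↔ i = 3) := fun i hi => by
    refine ⟨fun h => (hc.getVert_inj (by omega) (by omega)).mp
      (hc.eq_of_adj_of_adj hlen (by omega) (c.getVert_mem_support _)
        (c.getVert_mem_support _) hy h hy3), ?_⟩
    rintro rfl
    exact hy3
  have hxi' : ∀ i < 6, (G.Adj (c.getVert i) x ↔ i = 0) := fun i hi => by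
    rw [adj_comm, hxi i hi]
  have hyi' : ∀ i < 6, (G.Adj (c.getVert i) y ↔ i = 3) := fun i hi => by
    rw [adj_comm, hyi i hi]
  have hcc : ∀ i < 6, ∀ j < 6, (G.Adj (c.getVert i) (c.getVert j) ↔
      j = i + 1 ∨ i = j + 1 ∨ (i = 0 ∧ j + 1 = 6) ∨ (j = 0 ∧ i + 1 = 6)) := fun i hi j hj => by
    rw [hc.adj_getVert_iff hlen (by omega) (by omega), hlen6]
  let ι : Fin 4 → V := ![c.getVert 0, c.getVert 2, c.getVert 4, y]
  let κ : Fin 4 → V := ![c.getVert 1, c.getVert 3, c.getVert 5, x]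
  have hκ : (G.adjMatrix ℝ).submatrix κ κ = 0 := by
    ext i j
    fin_cases i <;> fin_cases j <;>
      simp [κ, -Walk.getVert_zero, hxi, hxi', hcc]
  have hι : (G.adjMatrix ℝ).submatrix ι ι = 0 := by
    ext i j
    fin_cases i <;> fin_cases j <;>
      simp [ι, -Walk.getVert_zero, hyi, hyi', hcc]
  have hκι : (G.adjMatrix ℝ).submatrix κ ι =
      !![1, 1, 0, 0; 0, 1, 1, 1; 1, 0, 1, 0; 1, 0, 0, 1] := by
    ext i j
    fin_cases i <;> fin_cases j <;>
      simp [ι, κ, -Walk.getVert_zero, hxi, hyi', hcc, hxy]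
  obtain ⟨L, hL, -⟩ := G.isSymm_adjMatrix.exists_linearMap_neg_of_submatrix
    (M := G.adjMatrix ℝ) ι κ hκ 1 (by
      intro z hz
      rw [hι, hκι]
      by_contra! hle
      simp [dotProduct, Matrix.mulVec, Fin.sum_univ_four] at hle
      have q1 := sq_nonneg (z 0 + z 1)
      have q2 := sq_nonneg (z 1 + z 2 + z 3)
      have q3 := sq_nonneg (z 0 + z 2)
      have q4 := sq_nonneg (z 0 + z 3)
      have h1 : z 0 + z 1 = 0 := by nlinarith only [hle, q1, q2, q3, q4]
      have h2 : z 1 + z 2 + z 3 = 0 := by nlinarith only [hle, q1, q2, q3, q4]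
      have h3 : z 0 + z 2 = 0 := by nlinarith only [hle, q1, q2, q3, q4]
      have h4 : z 0 + z 3 = 0 := by nlinarith only [hle, q1, q2, q3, q4]
      refine hz (funext fun i => ?_)
      fin_cases i <;> simp <;> linarith)
  exact ⟨L, hL⟩

theorem SimpleGraph.finrank_le_negInertia {V E : Type*} [Fintype V] (G : SimpleGraph V)
    [DecidableRel G.Adj] [AddCommGroup E] [Module ℝ E] [FiniteDimensional ℝ E]
    (L : E →ₗ[ℝ] V → ℝ) (hL : ∀ e ≠ 0, L e ⬝ᵥ G.adjMatrix ℝ *ᵥ L e < 0) :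
    finrank ℝ E ≤ G.negInertia := by
  classical
  unfold negInertia
  refine (Matrix.IsHermitian.finrank_le_card_neg_eigenvalues (G.adjMatrix_isHermitian) L ?_).trans
    (le_of_eq ?_)
  · exact hL
  · convert rfl

/-- Let `G` be connected, containing a cycle, with girth `g ≡ 2, 3 (mod 4)`, and not a
canonical unicyclic graph. If `n(G) = ⌈g/2⌉`, then `g = 3`. -/
theorem girth_eq_three_of_negInertia_eq_half_girth {V : Type*} [Fintype V]
    (G : SimpleGraph V) (hG : G.Connected) (hcyc : ¬ G.IsAcyclic)
    (g : ℕ) (hgirth : G.girth = g) (hmod : g % 4 = 2 ∨ g % 4 = 3)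
    (hnc : ¬ G.IsCanonicalUnicyclic) (hn : G.negInertia = (g + 1) / 2) :
    g = 3 := by
  classical
  obtain ⟨a, c, hc, hgc⟩ := exists_girth_eq_length.mpr hcyc
  have hlen := hgc.symm
  have h3 := hc.three_le_length
  by_contra hg3
  have hg6 : 6 ≤ G.girth := by omega
  have hedge : ∃ x y, x ∉ c.support ∧ y ∉ c.support ∧ G.Adj x y := by
    by_contra! hind
    exact hnc ⟨hG, a, c, hc, fun b d hd e =>
      hc.mem_edges_iff_of_isIndepSet hlen (by omega) hind hd e, hind⟩
  have key : ∀ x y, x ∉ c.support → y ∉ c.support → G.Adj x y →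
      ∃ v ∈ c.support, G.Adj y v := by
    intro x y hx hy hxy
    by_contra! hno
    obtain ⟨N, hN, L, hL, hLs⟩ := hc.exists_linearMap_neg hlen (by omega)
    obtain ⟨L', hL'⟩ := G.isSymm_adjMatrix.exists_linearMap_neg_prod (M := G.adjMatrix ℝ) L hL
      (x := x) (y := y) (by simp) (by simp) (by simp [hxy]) (by
        intro e
        refine Finset.sum_eq_zero fun v _ => ?_
        by_cases hv : v ∈ c.support
        · simp [hno v hv]
        · simp [hLs e v hv])
    have := G.finrank_le_negInertia L' hL'
    rw [finrank_prod, finrank_self, finrank_fin_fun] at this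
    omega
  obtain ⟨x, y, hx, hy, hxy⟩ := hedge
  obtain ⟨v, hv, hyv⟩ := key x y hx hy hxy
  obtain ⟨u, hu, hxu⟩ := key y x hy hx hxy.symm
  obtain ⟨h6, d, hd, hdl, hdv, hxd, hyd⟩ :=
    hc.girth_le_six hlen hg6 hu hv hx hy hxu.symm hxy hyv
  obtain ⟨L, hL⟩ := hd.exists_linearMap_neg_of_length_eq_six (by omega) hdl hxd hyd hxu.symm hxy
    (hdv ▸ hyv)
  have := G.finrank_le_negInertia L hL
  rw [finrank_fin_fun] at this
  omega
end

section
/- Let G be a finite connected simple graph with diameter d(G) = 2k + 1 for an integer k ≥ 0 and with n(G) = k + 1, and let P = v_1 v_2 … v_{2k+2} be a shortest path in G realizing the diameter (a geodesic of length 2k+1). Then every vertex of G is at distance at most 1 from V(P). -/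
open Matrix in
/-- If a Hermitian form is negative definite along a linear map out of `ι → ℝ`, then it has at
least `card ι` negative eigenvalues. -/
theorem Matrix.IsHermitian.card_le_card_neg_eigenvalues {V ι : Type*} [Fintype V] [DecidableEq V]
    [Fintype ι] {A : Matrix V V ℝ} (hA : A.IsHermitian) (L : Matrix V ι ℝ)
    (hneg : ∀ b : ι → ℝ, b ≠ 0 → L *ᵥ b ⬝ᵥ A *ᵥ (L *ᵥ b) < 0) :
    Fintype.card ι ≤ Fintype.card {i // hA.eigenvalues i < 0} := by
  by_contra! hlt
  set U : Matrix V V ℝ := (hA.eigenvectorUnitary : Matrix V V ℝ)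
  have hspec : A = U * diagonal hA.eigenvalues * Uᵀ := by
    have h := hA.spectral_theorem
    rwa [Unitary.conjStarAlgAut_apply, star_eq_conjTranspose,
      conjTranspose_eq_transpose_of_trivial] at h
  let f := ((Uᵀ * L).submatrix (fun i : {i // hA.eigenvalues i < 0} ↦ (i : V)) id).mulVecLin
  obtain ⟨b, hb, hb0⟩ := (Submodule.ne_bot_iff _).1
    (LinearMap.ker_ne_bot_of_finrank_lt (f := f) (by simpa using hlt))
  refine (hneg b hb0).not_ge ?_
  have hquad : L *ᵥ b ⬝ᵥ A *ᵥ (L *ᵥ b) = ∑ i, hA.eigenvalues i * ((Uᵀ * L) *ᵥ b) i ^ 2 := by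
    conv_lhs => rw [hspec]
    rw [← mulVec_mulVec, ← mulVec_mulVec, dotProduct_mulVec, ← mulVec_transpose, mulVec_mulVec,
      dotProduct]
    exact Finset.sum_congr rfl fun i _ ↦ by rw [mulVec_diagonal]; ring
  rw [hquad]
  refine Finset.sum_nonneg fun i _ ↦ ?_
  by_cases hi : hA.eigenvalues i < 0
  · have h0 : ((Uᵀ * L) *ᵥ b) i = 0 := congrFun (LinearMap.mem_ker.1 hb) ⟨i, hi⟩
    simp [h0]
  · exact mul_nonneg (not_lt.1 hi) (sq_nonneg _)

open Matrix in
/-- A sequence of edges `x i — y i` that can be stripped off one after the other as pendant edges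
bounds the negative inertia index from below. -/
theorem SimpleGraph.card_le_negInertia {V ι : Type*} [Fintype V] [Fintype ι] [LinearOrder ι]
    (G : SimpleGraph V) (x y : ι → V) (hxy : ∀ i, G.Adj (x i) (y i))
    (hxx : ∀ i j, i < j → ¬ G.Adj (x i) (x j)) (hxy' : ∀ i j, i < j → ¬ G.Adj (x i) (y j)) :
    Fintype.card ι ≤ G.negInertia := by
  classical
  set A := G.adjMatrix ℝ with hAdef
  set X : Matrix V ι ℝ := (1 : Matrix V V ℝ).submatrix id x
  set Y : Matrix V ι ℝ := (1 : Matrix V V ℝ).submatrix id y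
  have hAt : Aᵀ = A := G.isSymm_adjMatrix
  have hsub (z w : ι → V) : ((1 : Matrix V V ℝ).submatrix id z)ᵀ * A *
      (1 : Matrix V V ℝ).submatrix id w = A.submatrix z w := by
    ext i j
    simp [Matrix.mul_apply, Matrix.one_apply]
  have hXX : Xᵀ * A * X = 0 := by
    rw [hsub]
    ext i j
    rcases lt_trichotomy i j with h | rfl | h
    · simp [hAdef, hxx i j h]
    · simp [hAdef]
    · simpa [hAdef] using fun hadj ↦ hxx j i h hadj.symm
  set N := Xᵀ * A * Y with hN
  set S := Yᵀ * A * Y with hS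
  have hNt : Yᵀ * A * X = Nᵀ := by
    simp [hN, Matrix.transpose_mul, hAt, Matrix.mul_assoc]
  have hSt : Sᵀ = S := by
    simp [hS, Matrix.transpose_mul, hAt, Matrix.mul_assoc]
  have hdet : N.det = 1 := by
    have hN' : N = A.submatrix x y := hsub x y
    rw [hN', det_of_isLowerTriangular _ fun i j hij ↦ by
      simpa [hAdef] using hxy' i j (by simpa using hij)]
    simp [hAdef, hxy]
  set C := -((Nᵀ)⁻¹ * (1 + (1 / 2 : ℝ) • S))
  have hNC : Nᵀ * C = -(1 + (1 / 2 : ℝ) • S) := by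
    rw [Matrix.mul_neg, Matrix.mul_nonsing_inv_cancel_left _ _ (by simp [hdet])]
  have hCN : Cᵀ * N = -(1 + (1 / 2 : ℝ) • S) := by
    rw [← Matrix.transpose_transpose (Cᵀ * N), Matrix.transpose_mul, Matrix.transpose_transpose,
      hNC]
    simp [hSt]
  have hform : (X * C + Y)ᵀ * A * (X * C + Y) = (-2 : ℝ) • 1 := by
    calc (X * C + Y)ᵀ * A * (X * C + Y)
        = Cᵀ * (Xᵀ * A * X) * C + Cᵀ * (Xᵀ * A * Y) + Yᵀ * A * X * C + Yᵀ * A * Y := by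
          simp only [Matrix.transpose_add, Matrix.transpose_mul, Matrix.add_mul, Matrix.mul_add,
            Matrix.mul_assoc]
          abel
      _ = (-2 : ℝ) • 1 := by
          rw [hXX, hNt, hNC, ← hN, hCN, ← hS]
          simp only [Matrix.mul_zero, Matrix.zero_mul]
          module
  have hcard := G.adjMatrix_isHermitian.card_le_card_neg_eigenvalues (X * C + Y) fun b hb ↦ by
    have hpos : 0 < b ⬝ᵥ b := lt_of_le_of_ne
      (Finset.sum_nonneg fun i _ ↦ mul_self_nonneg (b i)) (Ne.symm (mt dotProduct_self_eq_zero.1 hb))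
    have hval : (X * C + Y) *ᵥ b ⬝ᵥ A *ᵥ ((X * C + Y) *ᵥ b) = -2 * (b ⬝ᵥ b) := by
      rw [mulVec_mulVec, dotProduct_comm, dotProduct_mulVec, ← mulVec_transpose, mulVec_mulVec,
        ← Matrix.mul_assoc, hform, smul_mulVec, one_mulVec, smul_dotProduct, smul_eq_mul]
    rw [hval]
    linarith
  unfold SimpleGraph.negInertia
  convert hcard

/-- A geodesic has no chords. -/
theorem SimpleGraph.Walk.not_adj_getVert_of_length_eq_dist {V : Type*} {G : SimpleGraph V}
    {u v : V} {p : G.Walk u v} (hp : p.length = G.dist u v) {i j : ℕ} (hij : i + 1 < j)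
    (hj : j ≤ p.length) : ¬ G.Adj (p.getVert i) (p.getVert j) := by
  intro hadj
  have hle := dist_le ((p.take i).append ((p.drop j).cons hadj))
  rw [length_append, length_cons, take_length, drop_length] at hle
  omega

/-- Let `G` be connected with diameter `2k + 1` and `n(G) = k + 1`, and let `P` be a
geodesic path of length `2k + 1` realizing the diameter. Then every vertex of `G` is
at distance at most `1` from `V(P)`. -/
theorem dist_le_one_of_diameter_path {V : Type*} [Fintype V] (G : SimpleGraph V)
    (hG : G.Connected) (k : ℕ) (hd : G.diam = 2 * k + 1) (hn : G.negInertia = k + 1)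
    {u v : V} (p : G.Walk u v) (hp : p.IsPath) (hgeo : p.length = G.dist u v)
    (hlen : p.length = 2 * k + 1) :
    ∀ x : V, ∃ y ∈ p.support, G.dist x y ≤ 1 := by
  intro x
  by_contra! hfar
  have hx (i : ℕ) : ¬ G.Adj x (p.getVert i) := fun h ↦
    (hfar _ (p.getVert_mem_support i)).ne' (SimpleGraph.dist_eq_one_iff_adj.2 h)
  have hxu : x ≠ u := by
    rintro rfl
    simpa using hfar x p.start_mem_support
  have : Nontrivial V := ⟨x, u, hxu⟩
  obtain ⟨y, hy⟩ := hG.preconnected.exists_adj_of_nontrivial x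
  have hcard := G.card_le_negInertia
    (Fin.cons x fun i : Fin (k + 1) ↦ p.getVert (2 * i) : Fin (k + 2) → V)
    (Fin.cons y fun i : Fin (k + 1) ↦ p.getVert (2 * i + 1) : Fin (k + 2) → V)
    (Fin.cases hy fun i ↦ p.adj_getVert_succ (by omega))
    (Fin.cases (Fin.cases (by simp) fun j _ ↦ hx _) fun i ↦ Fin.cases (by simp) fun j hij ↦
      p.not_adj_getVert_of_length_eq_dist hgeo (by grind) (by omega))
    (Fin.cases (Fin.cases (by simp) fun j _ ↦ hx _) fun i ↦ Fin.cases (by simp) fun j hij ↦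
      p.not_adj_getVert_of_length_eq_dist hgeo (by grind) (by omega))
  rw [hn, Fintype.card_fin] at hcard
  omega
end
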